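/- arXiv:2002.12260 — 2 statements merged into one kernel-verified Lean document; each statement's English description precedes it below -/
import Mathlib

section
/- (Exclusion of vanishing) Let 2<p<∞ and let (ζₙ) be a sequence of nonnegative functions in L¹(Π) ∩ L^p(Π) such that the sequences (‖ζₙ‖₁), (‖ζₙ‖_p) and (I(ζₙ)) are bounded and, for every R>0, sup_{y ∈ Π} ∫_{D(y,R) ∩ Π} ζₙ → 0 as n → ∞. Then E(ζₙ) → 0 as n → ∞. -/
open MeasureTheory Real Filter Topology

noncomputable section

/-- The open upper half-plane Π. -/
def UHP : Set (ℝ × ℝ) := {x | 0 < x.2}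

/-- Planar Lebesgue measure restricted to the upper half-plane. -/
def μUH : Measure (ℝ × ℝ) := MeasureTheory.volume.restrict UHP

/-- Squared Euclidean distance in the plane. -/
def sqdist (x y : ℝ × ℝ) : ℝ := (x.1 - y.1) ^ 2 + (x.2 - y.2) ^ 2

/-- Euclidean distance in the plane. -/
def euclDist (x y : ℝ × ℝ) : ℝ := Real.sqrt (sqdist x y)

/-- The Green's function of −Δ in the upper half-plane:
`G(x,y) = (1/(4π)) log(1 + 4 x₂ y₂ / |x−y|²)`. -/
def greenG (x y : ℝ × ℝ) : ℝ :=
  (4 * π)⁻¹ * Real.log (1 + 4 * x.2 * y.2 / sqdist x y)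

/-- The stream-function operator `𝒢ζ(x) = ∫_Π G(x,y) ζ(y) dy`. -/
def Gop (ζ : ℝ × ℝ → ℝ) (x : ℝ × ℝ) : ℝ := ∫ y, greenG x y * ζ y ∂μUH

/-- Kinetic energy `E(ζ) = (1/2) ∫_Π ζ 𝒢ζ`. -/
def energy (ζ : ℝ × ℝ → ℝ) : ℝ := (1 / 2) * ∫ x, ζ x * Gop ζ x ∂μUH

/-- Impulse `I(ζ) = ∫_Π ζ(y) y₂ dy`. -/
def impulse (ζ : ℝ × ℝ → ℝ) : ℝ := ∫ y, ζ y * y.2 ∂μUH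

/-- The `L^p(Π)` norm, as a real number. -/
def lpN (p : ℝ) (ζ : ℝ × ℝ → ℝ) : ℝ := (eLpNorm ζ (ENNReal.ofReal p) μUH).toReal

/-- `f ⪯ g` : `∫ (f−a)₊ ≤ ∫ (g−a)₊` for every `a > 0`. -/
def prec (f g : ℝ × ℝ → ℝ) : Prop :=
  ∀ a : ℝ, 0 < a → ∫ x, max (f x - a) 0 ∂μUH ≤ ∫ x, max (g x - a) 0 ∂μUH

/-- `f` is a rearrangement of `g` on Π. -/
def IsRearr (f g : ℝ × ℝ → ℝ) : Prop :=
  ∀ a : ℝ, 0 < a → μUH {x | a < f x} = μUH {x | a < g x}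

/-- Membership of the relaxed constraint class `𝒲(ζ₀)`. -/
def memW (ζ₀ ζ : ℝ × ℝ → ℝ) : Prop :=
  (∀ x, 0 ≤ ζ x) ∧ Integrable ζ μUH ∧ prec ζ ζ₀

/-- `𝒲(ζ₀, ≤ i₀)`. -/
def Wle (ζ₀ : ℝ × ℝ → ℝ) (i₀ : ℝ) : Set (ℝ × ℝ → ℝ) :=
  {ζ | memW ζ₀ ζ ∧ impulse ζ ≤ i₀}

/-- `𝒲(ζ₀, i₀)`. -/
def Weq (ζ₀ : ℝ × ℝ → ℝ) (i₀ : ℝ) : Set (ℝ × ℝ → ℝ) :=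
  {ζ | memW ζ₀ ζ ∧ impulse ζ = i₀}

/-- Membership of `ℛ⁺(ζ₀)`: restrictions of rearrangements of `ζ₀`. -/
def memRplus (ζ₀ ζ : ℝ × ℝ → ℝ) : Prop :=
  ∃ ξ : ℝ × ℝ → ℝ, ∃ A : Set (ℝ × ℝ), IsRearr ξ ζ₀ ∧ MeasurableSet A ∧
    ζ = A.indicator ξ

/-- Steiner symmetry about the `x₂`-axis. -/
def SteinerSym (ζ : ℝ × ℝ → ℝ) : Prop :=
  ∀ᵐ t ∂(MeasureTheory.volume.restrict (Set.Ioi (0 : ℝ))),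
    (∀ s : ℝ, ζ (-s, t) = ζ (s, t)) ∧
    (∀ s₁ s₂ : ℝ, 0 ≤ s₁ → s₁ ≤ s₂ → ζ (s₂, t) ≤ ζ (s₁, t))

/-- The decreasing rearrangement `ζ^Δ(s) = inf {a > 0 : |{ζ > a}| ≤ s}`. -/
def decRearr (ζ : ℝ × ℝ → ℝ) (s : ℝ) : ℝ :=
  sInf {a : ℝ | 0 < a ∧ μUH {x | a < ζ x} ≤ ENNReal.ofReal s}

/-- The norm `‖ζ‖_{𝔛^p} = |I(ζ)| + ‖ζ‖₁ + ‖ζ‖_p`. -/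
def XpNorm (p : ℝ) (ζ : ℝ × ℝ → ℝ) : ℝ := |impulse ζ| + lpN 1 ζ + lpN p ζ

/-- Distance to a set of functions in the `𝔛^p` norm. -/
def XpDist (p : ℝ) (ζ : ℝ × ℝ → ℝ) (S : Set (ℝ × ℝ → ℝ)) : ℝ :=
  sInf ((fun σ => XpNorm p fun x => ζ x - σ x) '' S)



/-- Truncated singular kernel `1/‖z‖` on the (sup-norm) ball of radius `R`. -/
def kern (R : ℝ) (z : ℝ × ℝ) : ENNReal :=
  (Metric.ball (0 : ℝ × ℝ) R).indicator (fun z => ENNReal.ofReal (‖z‖⁻¹)) z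

lemma kern_measurable (R : ℝ) : Measurable (kern R) := by
  unfold kern
  exact Measurable.indicator (by fun_prop) measurableSet_ball

lemma kern_neg (R : ℝ) (z : ℝ × ℝ) : kern R (-z) = kern R z := by
  unfold kern
  simp [Set.indicator]

lemma norm_sq_le_sqdist (x y : ℝ × ℝ) : ‖x - y‖ ^ 2 ≤ sqdist x y := by
  unfold sqdist
  rw [Prod.norm_def]
  rcases max_cases ‖(x - y).1‖ ‖(x - y).2‖ with ⟨h, _⟩ | ⟨h, _⟩ <;> rw [h] <;>
    simp only [Prod.fst_sub, Prod.snd_sub, Real.norm_eq_abs, sq_abs] <;> nlinarith [sq_nonneg (x.1 - y.1), sq_nonneg (x.2 - y.2)]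

lemma sqdist_le (x y : ℝ × ℝ) : sqdist x y ≤ 2 * ‖x - y‖ ^ 2 := by
  unfold sqdist
  have h1 : |x.1 - y.1| ≤ ‖x - y‖ := norm_fst_le (x - y)
  have h2 : |x.2 - y.2| ≤ ‖x - y‖ := norm_snd_le (x - y)
  have h3 := sq_le_sq' (by linarith [abs_nonneg (x.1 - y.1), norm_nonneg (x-y)]) h1
  have h4 := sq_le_sq' (by linarith [abs_nonneg (x.2 - y.2), norm_nonneg (x-y)]) h2
  rw [sq_abs] at h3 h4
  linarith

lemma greenG_nonneg {x y : ℝ × ℝ} (hx : 0 < x.2) (hy : 0 < y.2) : 0 ≤ greenG x y := by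
  unfold greenG sqdist
  apply mul_nonneg (by positivity)
  apply Real.log_nonneg
  have : 0 ≤ 4 * x.2 * y.2 / ((x.1 - y.1) ^ 2 + (x.2 - y.2) ^ 2) := by positivity
  linarith

lemma greenG_le_log {x y : ℝ × ℝ} (hx : 0 < x.2) (hy : 0 < y.2) :
    greenG x y ≤ Real.log (1 + 4 * x.2 * y.2 / sqdist x y) := by
  have h0 : 0 ≤ Real.log (1 + 4 * x.2 * y.2 / sqdist x y) := by
    apply Real.log_nonneg
    have : 0 ≤ 4 * x.2 * y.2 / sqdist x y := by unfold sqdist; positivity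
    linarith
  unfold greenG
  have : (4 * π)⁻¹ ≤ 1 := inv_le_one_of_one_le₀ (by linarith [Real.pi_gt_three])
  nlinarith

lemma greenG_far {x y : ℝ × ℝ} (hx : 0 < x.2) (hy : 0 < y.2) {R : ℝ} (hR : 0 < R)
    (h : R ≤ ‖x - y‖) : greenG x y ≤ 4 / R ^ 2 * (x.2 * y.2) := by
  have hs : R ^ 2 ≤ sqdist x y := le_trans (by gcongr) (norm_sq_le_sqdist x y)
  have hs0 : 0 < sqdist x y := lt_of_lt_of_le (by positivity) hs
  have ht : 0 ≤ 4 * x.2 * y.2 / sqdist x y := by positivity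
  calc greenG x y ≤ _ := greenG_le_log hx hy
    _ ≤ 4 * x.2 * y.2 / sqdist x y := by
      have := Real.log_le_sub_one_of_pos (show 0 < 1 + 4 * x.2 * y.2 / sqdist x y by linarith)
      linarith
    _ ≤ 4 * x.2 * y.2 / R ^ 2 := by gcongr
    _ = _ := by ring

lemma greenG_near {x y : ℝ × ℝ} (hx : 0 < x.2) (hy : 0 < y.2) :
    greenG x y ≤ 2 * (x.2 + y.2) * ‖x - y‖⁻¹ := by
  by_cases hxy : x = y
  · subst hxy; simp [greenG, sqdist]
  have hd : 0 < ‖x - y‖ := norm_pos_iff.mpr (sub_ne_zero.mpr hxy)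
  have hs := norm_sq_le_sqdist x y
  have hs0 : 0 < sqdist x y := lt_of_lt_of_le (by positivity) hs
  set u := (x.2 + y.2) * ‖x - y‖⁻¹ with hu
  have hu0 : 0 < u := by positivity
  have ht : 0 ≤ 4 * x.2 * y.2 / sqdist x y := by positivity
  have h1 : 4 * x.2 * y.2 / sqdist x y ≤ u ^ 2 := by
    calc 4 * x.2 * y.2 / sqdist x y ≤ (x.2 + y.2) ^ 2 / ‖x - y‖ ^ 2 := by
          gcongr
          nlinarith [sq_nonneg (x.2 - y.2)]
      _ = u ^ 2 := by rw [hu]; field_simp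
  calc greenG x y ≤ _ := greenG_le_log hx hy
    _ ≤ Real.log ((1 + u) ^ 2) := by
      apply Real.log_le_log (by linarith)
      nlinarith
    _ = 2 * Real.log (1 + u) := by rw [Real.log_pow]; norm_num
    _ ≤ 2 * u := by
      have := Real.log_le_sub_one_of_pos (show 0 < 1 + u by linarith)
      linarith
    _ = _ := by rw [hu]; ring

lemma greenG_bound {x y : ℝ × ℝ} (hx : 0 < x.2) (hy : 0 < y.2) {R : ℝ} (hR : 0 < R) :
    ‖greenG x y‖ₑ ≤ ENNReal.ofReal (4 / R ^ 2) * (ENNReal.ofReal x.2 * ENNReal.ofReal y.2)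
      + 2 * (ENNReal.ofReal x.2 + ENNReal.ofReal y.2) * kern R (x - y) := by
  rw [Real.enorm_of_nonneg (greenG_nonneg hx hy)]
  by_cases h : ‖x - y‖ < R
  · refine le_trans ?_ le_add_self
    have : kern R (x - y) = ENNReal.ofReal (‖x - y‖⁻¹) := by
      unfold kern
      rw [Set.indicator_of_mem (by simpa using h)]
    rw [this, ← ENNReal.ofReal_add hx.le hy.le, show (2 : ENNReal) = ENNReal.ofReal 2 by simp,
      ← ENNReal.ofReal_mul (by norm_num), ← ENNReal.ofReal_mul (by positivity)]
    exact ENNReal.ofReal_le_ofReal (greenG_near hx hy)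
  · refine le_trans ?_ le_self_add
    rw [← ENNReal.ofReal_mul hx.le, ← ENNReal.ofReal_mul (by positivity)]
    exact ENNReal.ofReal_le_ofReal (greenG_far hx hy hR (not_lt.mp h))

lemma measurableSet_UHP : MeasurableSet UHP := measurableSet_lt measurable_const measurable_snd

lemma ae_UHP : ∀ᵐ x ∂μUH, 0 < x.2 := by
  unfold μUH
  exact ae_restrict_mem measurableSet_UHP

instance : SFinite μUH := by unfold μUH; infer_instance

lemma kern_le (R : ℝ) {δ : ℝ} (hδ : 0 < δ) (z : ℝ × ℝ) :
    kern R z ≤ kern δ z + ENNReal.ofReal (δ⁻¹) * (Metric.ball (0 : ℝ × ℝ) R).indicator 1 z := by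
  unfold kern
  by_cases hz : z ∈ Metric.ball (0 : ℝ × ℝ) R
  · rw [Set.indicator_of_mem hz, Set.indicator_of_mem hz]
    by_cases hz' : z ∈ Metric.ball (0 : ℝ × ℝ) δ
    · rw [Set.indicator_of_mem hz']; exact le_self_add
    · refine le_trans ?_ le_add_self
      simp only [Metric.mem_ball, dist_zero_right, not_lt] at hz'
      simp only [Pi.one_apply, mul_one]
      exact ENNReal.ofReal_le_ofReal (inv_anti₀ hδ hz')
  · rw [Set.indicator_of_notMem hz]; exact zero_le

lemma kern_Lq_small {q : ℝ} (hq0 : 0 < q) (hq : q < 2) {ε : ENNReal} (hε : ε ≠ 0) :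
    ∃ δ : ℝ, 0 < δ ∧ (∫⁻ z, kern δ z ^ q) ^ (1 / q) ≤ ε := by
  have hloc : IntegrableOn (fun z : ℝ × ℝ => ‖z‖ ^ (-q)) (Metric.ball 0 1) := by
    have hl : LocallyIntegrable (fun z : ℝ × ℝ => ‖z‖ ^ (-q)) volume := by
      refine locallyIntegrable_of_norm_le_rpow (C := 1) (α := q) (by simp) (by simpa using hq)
        (ae_of_all _ fun x => ?_) ?_
      · rw [Real.norm_of_nonneg (by positivity), one_mul]
      · exact (by fun_prop : Measurable (fun z : ℝ × ℝ => ‖z‖ ^ (-q))).aestronglyMeasurable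
    exact (hl.integrableOn_isCompact (isCompact_closedBall 0 1)).mono_set
      Metric.ball_subset_closedBall
  have hfin : ∫⁻ z in Metric.ball (0 : ℝ × ℝ) 1, ENNReal.ofReal (‖z‖⁻¹) ^ q ≠ ⊤ := by
    have h1 := hloc.2
    unfold HasFiniteIntegral at h1
    refine ne_of_lt (lt_of_le_of_lt (lintegral_mono fun z => ?_) h1)
    beta_reduce
    rw [Real.enorm_of_nonneg (by positivity), ENNReal.ofReal_rpow_of_nonneg (by positivity) hq0.le,
      Real.rpow_neg (by positivity), Real.inv_rpow (by positivity)]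
  have hε' : ε ^ q ≠ 0 := by
    simp [ENNReal.rpow_eq_zero_iff, hε, hq0, hq0.le]
  obtain ⟨d, hd, hsmall⟩ := exists_pos_setLIntegral_lt_of_measure_lt hfin hε'
  have htend : Tendsto (fun r : ℝ => volume (Metric.ball (0 : ℝ × ℝ) r)) (𝓝[>] 0) (𝓝 0) := by
    have : Tendsto (fun r : ℝ => ENNReal.ofReal (2 * r) * ENNReal.ofReal (2 * r)) (𝓝[>] 0)
        (𝓝 0) := by
      have h2 : Tendsto (fun r : ℝ => ENNReal.ofReal (2 * r * (2 * r))) (𝓝 0) (𝓝 0) := by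
        have : Continuous (fun r : ℝ => ENNReal.ofReal (2 * r * (2 * r))) :=
          ENNReal.continuous_ofReal.comp (by fun_prop)
        simpa using this.tendsto 0
      refine (h2.mono_left nhdsWithin_le_nhds).congr' ?_
      filter_upwards [self_mem_nhdsWithin] with r hr
      have hr : 0 < r := hr
      rw [ENNReal.ofReal_mul (by positivity)]
    refine this.congr fun r => ?_
    have : Metric.ball (0 : ℝ × ℝ) r = Metric.ball 0 r ×ˢ Metric.ball 0 r :=
      (ball_prod_same (0 : ℝ) (0 : ℝ) r).symm
    rw [this, Measure.volume_eq_prod, Measure.prod_prod, Real.volume_ball]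
  have hev : ∀ᶠ r in 𝓝[>] (0 : ℝ), volume (Metric.ball (0 : ℝ × ℝ) r) < d :=
    htend.eventually (gt_mem_nhds hd)
  have hev2 : ∀ᶠ r in 𝓝[>] (0 : ℝ), r < 1 :=
    nhdsWithin_le_nhds (gt_mem_nhds one_pos)
  have hev3 : ∀ᶠ r in 𝓝[>] (0 : ℝ), 0 < r := self_mem_nhdsWithin
  obtain ⟨r, hr1, hr2, hr3⟩ := (hev.and (hev2.and hev3)).exists
  refine ⟨r, hr3, ?_⟩
  have h1 : ∫⁻ z, kern r z ^ q = ∫⁻ z in Metric.ball (0 : ℝ × ℝ) r, ENNReal.ofReal (‖z‖⁻¹) ^ q := by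
    rw [← lintegral_indicator measurableSet_ball]
    congr 1
    ext z
    unfold kern
    by_cases hz : z ∈ Metric.ball (0 : ℝ × ℝ) r
    · simp only [Set.indicator_of_mem hz]
    · simp only [Set.indicator_of_notMem hz, ENNReal.zero_rpow_of_pos hq0]
  have h2 := hsmall (Metric.ball 0 r)
    (lt_of_le_of_lt (Measure.restrict_apply_le _ _) hr1)
  rw [Measure.restrict_restrict measurableSet_ball,
    Set.inter_eq_left.mpr (Metric.ball_subset_ball hr2.le)] at h2
  rw [h1]
  calc _ ≤ (ε ^ q) ^ (1 / q) := ENNReal.rpow_le_rpow h2.le (by positivity)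
    _ = ε := by rw [← ENNReal.rpow_mul, mul_one_div_cancel hq0.ne', ENNReal.rpow_one]

/-- Energy bound in terms of the impulse and a uniform bound on the truncated potential. -/
lemma energy_bound {ζ : ℝ × ℝ → ℝ} (hae : AEMeasurable ζ μUH) {R : ℝ} (hR : 0 < R)
    {I M : ENNReal} (hI : ∫⁻ y, ‖ζ y‖ₑ * ENNReal.ofReal y.2 ∂μUH ≤ I)
    (hM : ∀ x ∈ UHP, ∫⁻ y, ‖ζ y‖ₑ * kern R (x - y) ∂μUH ≤ M) :
    ‖energy ζ‖ₑ ≤ ENNReal.ofReal (4 / R ^ 2) * (I * I) + 4 * (I * M) := by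
  have hf : AEMeasurable (fun y => ‖ζ y‖ₑ) μUH := hae.enorm
  have hk := kern_measurable R
  have hfy : AEMeasurable (fun y : ℝ × ℝ => ‖ζ y‖ₑ * ENNReal.ofReal y.2) μUH :=
    hf.mul (by fun_prop)
  have step1 : ‖energy ζ‖ₑ ≤ ∫⁻ x, ‖ζ x‖ₑ * ∫⁻ y, ‖greenG x y‖ₑ * ‖ζ y‖ₑ ∂μUH ∂μUH := by
    unfold energy
    rw [enorm_mul]
    have : ‖(1 / 2 : ℝ)‖ₑ ≤ 1 := by
      rw [Real.enorm_of_nonneg (by norm_num)]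
      simpa using ENNReal.ofReal_le_ofReal (show (1/2 : ℝ) ≤ 1 by norm_num)
    calc _ ≤ 1 * ‖∫ x, ζ x * Gop ζ x ∂μUH‖ₑ := by gcongr
      _ = ‖∫ x, ζ x * Gop ζ x ∂μUH‖ₑ := one_mul _
      _ ≤ ∫⁻ x, ‖ζ x * Gop ζ x‖ₑ ∂μUH := enorm_integral_le_lintegral_enorm _
      _ ≤ _ := by
        refine lintegral_mono fun x => ?_
        simp only [enorm_mul]
        gcongr
        unfold Gop
        refine (enorm_integral_le_lintegral_enorm _).trans (le_of_eq ?_)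
        simp only [enorm_mul]
  set A : ENNReal := ENNReal.ofReal (4 / R ^ 2) with hA
  have hAtop : A ≠ ⊤ := ENNReal.ofReal_ne_top
  have hkx : ∀ x : ℝ × ℝ, AEMeasurable (fun y => ‖ζ y‖ₑ * kern R (x - y)) μUH := fun x =>
    hf.mul (hk.comp (measurable_const.sub measurable_id)).aemeasurable
  have hkx2 : ∀ x : ℝ × ℝ,
      AEMeasurable (fun y => (‖ζ y‖ₑ * ENNReal.ofReal y.2) * kern R (x - y)) μUH := fun x =>
    hfy.mul (hk.comp (measurable_const.sub measurable_id)).aemeasurable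
  have step2 : ∀ᵐ x ∂μUH, ‖ζ x‖ₑ * ∫⁻ y, ‖greenG x y‖ₑ * ‖ζ y‖ₑ ∂μUH ≤
      A * I * (‖ζ x‖ₑ * ENNReal.ofReal x.2) + 2 * M * (‖ζ x‖ₑ * ENNReal.ofReal x.2)
        + 2 * (‖ζ x‖ₑ * ∫⁻ y, (‖ζ y‖ₑ * ENNReal.ofReal y.2) * kern R (x - y) ∂μUH) := by
    filter_upwards [ae_UHP] with x hx
    have hin : ∫⁻ y, ‖greenG x y‖ₑ * ‖ζ y‖ₑ ∂μUH ≤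
        A * ENNReal.ofReal x.2 * I + 2 * ENNReal.ofReal x.2 * M
         + 2 * ∫⁻ y, (‖ζ y‖ₑ * ENNReal.ofReal y.2) * kern R (x - y) ∂μUH := by
      calc _ ≤ ∫⁻ y, (A * ENNReal.ofReal x.2 * (‖ζ y‖ₑ * ENNReal.ofReal y.2)
            + 2 * ENNReal.ofReal x.2 * (‖ζ y‖ₑ * kern R (x - y)))
            + 2 * ((‖ζ y‖ₑ * ENNReal.ofReal y.2) * kern R (x - y)) ∂μUH := by
            refine lintegral_mono_ae ?_
            filter_upwards [ae_UHP] with y hy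
            calc _ ≤ _ := mul_le_mul_left (greenG_bound hx hy hR) _
              _ = _ := by ring
        _ = A * ENNReal.ofReal x.2 * ∫⁻ y, (‖ζ y‖ₑ * ENNReal.ofReal y.2) ∂μUH
            + 2 * ENNReal.ofReal x.2 * ∫⁻ y, (‖ζ y‖ₑ * kern R (x - y)) ∂μUH
            + 2 * ∫⁻ y, (‖ζ y‖ₑ * ENNReal.ofReal y.2) * kern R (x - y) ∂μUH := by
            rw [lintegral_add_right' _ ((hkx2 x).const_mul _),
              lintegral_add_right' _ ((hkx x).const_mul _),
              lintegral_const_mul'' _ hfy, lintegral_const_mul'' _ (hkx x),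
              lintegral_const_mul'' _ (hkx2 x)]
        _ ≤ _ := by
            gcongr
            exact hM x hx
    calc _ ≤ _ := mul_le_mul_right hin _
      _ = _ := by ring
  have hswap : ∫⁻ x, ‖ζ x‖ₑ * ∫⁻ y, (‖ζ y‖ₑ * ENNReal.ofReal y.2) * kern R (x - y) ∂μUH ∂μUH
      ≤ I * M := by
    have hkk : Measurable (fun z : (ℝ × ℝ) × (ℝ × ℝ) => kern R (z.1 - z.2)) :=
      hk.comp (measurable_fst.sub measurable_snd)
    calc _ = ∫⁻ x, ∫⁻ y, ‖ζ x‖ₑ * ((‖ζ y‖ₑ * ENNReal.ofReal y.2) * kern R (x - y)) ∂μUH ∂μUH := by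
          refine lintegral_congr fun x => ?_
          rw [lintegral_const_mul'' _ (hkx2 x)]
      _ = ∫⁻ y, ∫⁻ x, ‖ζ x‖ₑ * ((‖ζ y‖ₑ * ENNReal.ofReal y.2) * kern R (x - y)) ∂μUH ∂μUH := by
          apply lintegral_lintegral_swap
          exact (hf.comp_fst).mul ((hfy.comp_snd).mul hkk.aemeasurable)
      _ ≤ ∫⁻ y, (‖ζ y‖ₑ * ENNReal.ofReal y.2) * M ∂μUH := by
          refine lintegral_mono_ae ?_
          filter_upwards [ae_UHP] with y hy
          calc _ = ∫⁻ x, (‖ζ y‖ₑ * ENNReal.ofReal y.2) * (‖ζ x‖ₑ * kern R (y - x)) ∂μUH := by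
                refine lintegral_congr fun x => ?_
                rw [← kern_neg R (y - x), neg_sub]
                ring
            _ = _ := lintegral_const_mul'' _ (hkx y)
            _ ≤ _ := by gcongr; exact hM y hy
      _ = (∫⁻ y, (‖ζ y‖ₑ * ENNReal.ofReal y.2) ∂μUH) * M := lintegral_mul_const'' _ hfy
      _ ≤ _ := by gcongr
  calc _ ≤ _ := step1
    _ ≤ _ := lintegral_mono_ae step2
    _ ≤ A * I * ∫⁻ x, (‖ζ x‖ₑ * ENNReal.ofReal x.2) ∂μUH
        + 2 * M * ∫⁻ x, (‖ζ x‖ₑ * ENNReal.ofReal x.2) ∂μUH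
        + 2 * ∫⁻ x, ‖ζ x‖ₑ * ∫⁻ y, (‖ζ y‖ₑ * ENNReal.ofReal y.2) * kern R (x - y) ∂μUH ∂μUH := by
        have hsum : AEMeasurable (fun x => A * I * (‖ζ x‖ₑ * ENNReal.ofReal x.2)
            + 2 * M * (‖ζ x‖ₑ * ENNReal.ofReal x.2)) μUH :=
          (hfy.const_mul _).add (hfy.const_mul _)
        rw [lintegral_add_left' hsum,
          lintegral_add_left' (hfy.const_mul _),
          lintegral_const_mul'' _ hfy, lintegral_const_mul'' _ hfy,
          lintegral_const_mul' _ _ (by simp)]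
    _ ≤ A * I * I + 2 * M * I + 2 * (I * M) := by gcongr
    _ = _ := by ring

lemma potential_bound {p : ℝ} (hp : 2 < p) {ζ : ℝ × ℝ → ℝ} (hae : AEMeasurable ζ μUH)
    {R δ : ℝ} (hδ : 0 < δ) (x : ℝ × ℝ) :
    ∫⁻ y, ‖ζ y‖ₑ * kern R (x - y) ∂μUH ≤
      eLpNorm ζ (ENNReal.ofReal p) μUH * (∫⁻ z, kern δ z ^ (p / (p - 1))) ^ (1 / (p / (p - 1)))
      + ENNReal.ofReal (δ⁻¹) * ∫⁻ y in Metric.ball x R, ‖ζ y‖ₑ ∂μUH := by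
  have hf : AEMeasurable (fun y => ‖ζ y‖ₑ) μUH := hae.enorm
  have hkm : Measurable (fun y => kern δ (x - y)) :=
    (kern_measurable δ).comp (measurable_const.sub measurable_id)
  have hpq : p.HolderConjugate (p / (p - 1)) := Real.HolderConjugate.conjExponent (by linarith)
  have hq0 : 0 < p / (p - 1) := div_pos (by linarith) (by linarith)
  have hH := ENNReal.lintegral_mul_le_Lp_mul_Lq μUH hpq hf hkm.aemeasurable
  have hN : eLpNorm ζ (ENNReal.ofReal p) μUH = (∫⁻ y, ‖ζ y‖ₑ ^ p ∂μUH) ^ (1 / p) := by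
    rw [eLpNorm_eq_lintegral_rpow_enorm_toReal (by simp; linarith) ENNReal.ofReal_ne_top,
      ENNReal.toReal_ofReal (by linarith)]
  have hT : ∫⁻ y, kern δ (x - y) ^ (p / (p - 1)) ∂μUH ≤ ∫⁻ z, kern δ z ^ (p / (p - 1)) := by
    calc _ ≤ ∫⁻ y, kern δ (x - y) ^ (p / (p - 1)) :=
          lintegral_mono' Measure.restrict_le_self le_rfl
      _ = _ := lintegral_sub_left_eq_self (fun z => kern δ z ^ (p / (p - 1))) x
  have hind : ∀ y, (Metric.ball (0 : ℝ × ℝ) R).indicator (1 : ℝ × ℝ → ENNReal) (x - y)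
      = (Metric.ball x R).indicator 1 y := by
    intro y
    simp only [Set.indicator, Metric.mem_ball, dist_eq_norm, sub_zero, norm_sub_rev y x]
    rfl
  calc _ ≤ ∫⁻ y, ‖ζ y‖ₑ * kern δ (x - y)
        + ENNReal.ofReal (δ⁻¹) * (Metric.ball x R).indicator (fun y => ‖ζ y‖ₑ) y ∂μUH := by
        refine lintegral_mono fun y => ?_
        calc _ ≤ _ := mul_le_mul_right (kern_le R hδ (x - y)) _
          _ = _ := by
            rw [hind, mul_add]
            congr 1
            by_cases hy : y ∈ Metric.ball x R
            · simp only [Set.indicator_of_mem hy, Pi.one_apply]; ring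
            · simp only [Set.indicator_of_notMem hy]; ring
    _ = ∫⁻ y, ‖ζ y‖ₑ * kern δ (x - y) ∂μUH
        + ENNReal.ofReal (δ⁻¹) * ∫⁻ y in Metric.ball x R, ‖ζ y‖ₑ ∂μUH := by
        have hprod : AEMeasurable (fun y => ‖ζ y‖ₑ * kern δ (x - y)) μUH :=
          hf.mul hkm.aemeasurable
        rw [lintegral_add_left' hprod,
          lintegral_const_mul' _ _ ENNReal.ofReal_ne_top, lintegral_indicator measurableSet_ball]
    _ ≤ _ := by
        rw [hN]
        gcongr
        refine hH.trans ?_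
        gcongr

/-- Exclusion of Vanishing: if mass vanishes locally uniformly then the
energy tends to zero. -/
theorem stmt_15 (p : ℝ) (hp : 2 < p)
    (ζn : ℕ → ℝ × ℝ → ℝ)
    (hnn : ∀ n x, 0 ≤ ζn n x)
    (hint : ∀ n, Integrable (ζn n) μUH)
    (hmem : ∀ n, MemLp (ζn n) (ENNReal.ofReal p) μUH)
    (himpint : ∀ n, Integrable (fun y => ζn n y * y.2) μUH)
    (hbdd : ∃ C : ℝ, ∀ n, lpN 1 (ζn n) ≤ C ∧ lpN p (ζn n) ≤ C ∧ impulse (ζn n) ≤ C)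
    (hvan : ∀ R : ℝ, 0 < R → ∀ ε : ℝ, 0 < ε → ∃ N : ℕ, ∀ n ≥ N, ∀ y ∈ UHP,
      ∫ x in {x | euclDist x y < R}, ζn n x ∂μUH ≤ ε) :
    Tendsto (fun n => energy (ζn n)) atTop (nhds 0) := by
  classical
  obtain ⟨C₀, hC₀⟩ := hbdd
  set C := max C₀ 1 with hC
  have hC1 : 1 ≤ C := le_max_right _ _
  have hCpos : 0 < C := by linarith
  rw [Metric.tendsto_atTop]
  intro ε hε
  -- choose the parameters
  set R : ℝ := 4 * C / Real.sqrt ε with hRdef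
  have hsq : 0 < Real.sqrt ε := Real.sqrt_pos.mpr hε
  have hR : 0 < R := by positivity
  have hR2 : 4 / R ^ 2 * (C * C) = ε / 4 := by
    rw [hRdef, div_pow, Real.sq_sqrt hε.le]
    field_simp
  set c : ℝ := ε / (16 * C * C) with hcdef
  have hc : 0 < c := by positivity
  obtain ⟨δ, hδ, hkq⟩ := kern_Lq_small (q := p / (p - 1))
    (div_pos (by linarith) (by linarith)) (by rw [div_lt_iff₀ (by linarith)]; linarith)
    (ε := ENNReal.ofReal c) (by simpa using hc)
  set η : ℝ := ε * δ / (16 * C) with hηdef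
  have hη : 0 < η := by positivity
  obtain ⟨N, hN⟩ := hvan (2 * R) (by positivity) η hη
  refine ⟨N, fun n hn => ?_⟩
  have hae : AEMeasurable (ζn n) μUH := (hint n).1.aemeasurable
  have hI : ∫⁻ y, ‖ζn n y‖ₑ * ENNReal.ofReal y.2 ∂μUH ≤ ENNReal.ofReal C := by
    have h1 : ∫⁻ y, ‖ζn n y‖ₑ * ENNReal.ofReal y.2 ∂μUH
        = ∫⁻ y, ENNReal.ofReal (ζn n y * y.2) ∂μUH := by
      refine lintegral_congr fun y => ?_
      rw [Real.enorm_of_nonneg (hnn n y), ENNReal.ofReal_mul (hnn n y)]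
    rw [h1, ← ofReal_integral_eq_lintegral_ofReal (himpint n)]
    · exact ENNReal.ofReal_le_ofReal ((hC₀ n).2.2.trans (le_max_left _ _))
    · filter_upwards [ae_UHP] with y hy
      exact mul_nonneg (hnn n y) hy.le
  have hLp : eLpNorm (ζn n) (ENNReal.ofReal p) μUH ≤ ENNReal.ofReal C := by
    rw [← ENNReal.ofReal_toReal (hmem n).2.ne]
    exact ENNReal.ofReal_le_ofReal ((hC₀ n).2.1.trans (le_max_left _ _))
  have hM : ∀ x ∈ UHP, ∫⁻ y, ‖ζn n y‖ₑ * kern R (x - y) ∂μUH ≤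
      ENNReal.ofReal (C * c + δ⁻¹ * η) := by
    intro x hx
    refine (potential_bound hp hae hδ x).trans ?_
    rw [ENNReal.ofReal_add (by positivity) (by positivity), ENNReal.ofReal_mul hCpos.le,
      ENNReal.ofReal_mul (by positivity)]
    gcongr
    have hsub : Metric.ball x R ⊆ {y | euclDist y x < 2 * R} := by
      intro y hy
      rw [Metric.mem_ball, dist_eq_norm] at hy
      have h1 := sqdist_le y x
      show Real.sqrt (sqdist y x) < 2 * R
      rw [Real.sqrt_lt' (by positivity)]
      nlinarith [norm_nonneg (y - x)]
    calc _ ≤ ∫⁻ y in {y | euclDist y x < 2 * R}, ‖ζn n y‖ₑ ∂μUH := lintegral_mono_set hsub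
      _ = ∫⁻ y in {y | euclDist y x < 2 * R}, ENNReal.ofReal (ζn n y) ∂μUH :=
          lintegral_congr fun y => Real.enorm_of_nonneg (hnn n y)
      _ = ENNReal.ofReal (∫ y in {y | euclDist y x < 2 * R}, ζn n y ∂μUH) := by
          rw [ofReal_integral_eq_lintegral_ofReal (hint n).restrict (ae_of_all _ (hnn n))]
      _ ≤ _ := ENNReal.ofReal_le_ofReal (hN n hn x hx)
  have hE := energy_bound hae hR hI hM
  have h4 : (4 : ENNReal) = ENNReal.ofReal 4 := by simp
  rw [h4, ← ENNReal.ofReal_mul hCpos.le, ← ENNReal.ofReal_mul hCpos.le,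
    ← ENNReal.ofReal_mul (by positivity), ← ENNReal.ofReal_mul (by positivity),
    ← ENNReal.ofReal_add (by positivity) (by positivity), ← ofReal_norm,
    ENNReal.ofReal_le_ofReal_iff (by positivity), hR2] at hE
  rw [dist_zero_right]
  have h5 : 4 * (C * (C * c + δ⁻¹ * η)) = ε / 2 := by
    rw [hcdef, hηdef]
    field_simp
    norm_num
  linarith
end
end

section
/- Let 1 ≤ p < ∞ and let f, g be nonnegative functions in L^p on (possibly different) measurable subsets of Euclidean spaces equipped with Lebesgue measure. Then f is a rearrangement of g (i.e. |{f>α}| = |{g>α}| for every α>0) if and only if both f ⪯ g and g ⪯ f hold. -/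
open MeasureTheory Real Filter Topology

noncomputable section

/-- Superlevel sets at positive heights of an `L^p` function have finite measure. -/
lemma aux_fin {α : Type*} [MeasurableSpace α] {μ : Measure α} {p : ℝ} (hp : 1 ≤ p)
    {f : α → ℝ} (hfp : MemLp f (ENNReal.ofReal p) μ)
    {a : ℝ} (ha : 0 < a) : μ {x | a < f x} < ⊤ := by
  have h := hfp.meas_ge_lt_top (ε := a.toNNReal)
    (by simp; linarith) ENNReal.ofReal_ne_top (by simpa using ha)
  refine lt_of_le_of_lt (measure_mono ?_) h
  intro x hx
  have hx' : a < f x := hx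
  show a.toNNReal ≤ ‖f x‖₊
  rw [← NNReal.coe_le_coe, Real.coe_toNNReal _ ha.le, coe_nnnorm]
  exact hx'.le.trans (Real.le_norm_self _)

lemma aux_null {α : Type*} [MeasurableSpace α] {μ : Measure α} {q : ENNReal}
    {f : α → ℝ} (hfp : MemLp f q μ) (a : ℝ) : NullMeasurableSet {x | a < f x} μ :=
  nullMeasurableSet_lt aemeasurable_const hfp.1.aemeasurable

lemma aux_int {α : Type*} [MeasurableSpace α] {μ : Measure α} {p : ℝ} (hp : 1 ≤ p)
    {f : α → ℝ} (hfp : MemLp f (ENNReal.ofReal p) μ)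
    {a : ℝ} (ha : 0 < a) : Integrable (fun x => max (f x - a) 0) μ := by
  have hfin := aux_fin hp hfp ha
  have : IsFiniteMeasure (μ.restrict {x | a < f x}) := ⟨by simpa using hfin⟩
  have h1 : IntegrableOn (fun x => f x - a) {x | a < f x} μ := by
    have h2 : Integrable f (μ.restrict {x | a < f x}) :=
      (hfp.restrict _).integrable (by simpa using hp)
    exact h2.sub (integrable_const a)
  have h3 := h1.integrable_indicator₀ (aux_null hfp a)
  refine h3.congr (Eventually.of_forall fun x => ?_)
  by_cases hx : a < f x
  · have : x ∈ {x | a < f x} := hx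
    simp only [Set.indicator_of_mem this]
    rw [max_eq_left (by linarith)]
  · have : x ∉ {x | a < f x} := hx
    simp only [Set.indicator_of_notMem this]
    rw [max_eq_right (by linarith)]

lemma aux_lower {α : Type*} [MeasurableSpace α] {μ : Measure α} {p : ℝ} (hp : 1 ≤ p)
    {f : α → ℝ} (hfp : MemLp f (ENNReal.ofReal p) μ)
    {a b : ℝ} (ha : 0 < a) (hab : a < b) :
    (b - a) * μ.real {x | b < f x} ≤
      ∫ x, max (f x - a) 0 ∂μ - ∫ x, max (f x - b) 0 ∂μ := by
  have hb := ha.trans hab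
  rw [← integral_sub (aux_int hp hfp ha) (aux_int hp hfp hb)]
  have e : (b - a) * μ.real {x | b < f x} =
      ∫ x, ({x | b < f x}).indicator (fun _ => b - a) x ∂μ := by
    rw [integral_indicator₀ (aux_null hfp b), setIntegral_const, smul_eq_mul, mul_comm]
  rw [e]
  refine integral_mono ?_ ((aux_int hp hfp ha).sub (aux_int hp hfp hb)) fun x => ?_
  · exact IntegrableOn.integrable_indicator₀ (integrableOn_const (aux_fin hp hfp hb).ne) (aux_null hfp b)
  · show ({x | b < f x}).indicator (fun _ => b - a) x ≤ max (f x - a) 0 - max (f x - b) 0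
    by_cases hx : b < f x
    · have h : x ∈ {x | b < f x} := hx
      rw [Set.indicator_of_mem h, max_eq_left (by linarith), max_eq_left (by linarith)]
      linarith
    · have h : x ∉ {x | b < f x} := hx
      rw [Set.indicator_of_notMem h, max_eq_right (a := f x - b) (by linarith)]
      simp

lemma aux_upper {α : Type*} [MeasurableSpace α] {μ : Measure α} {p : ℝ} (hp : 1 ≤ p)
    {f : α → ℝ} (hfp : MemLp f (ENNReal.ofReal p) μ)
    {a b : ℝ} (ha : 0 < a) (hab : a < b) :
    ∫ x, max (f x - a) 0 ∂μ - ∫ x, max (f x - b) 0 ∂μ ≤ (b - a) * μ.real {x | a < f x} := by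
  have hb := ha.trans hab
  rw [← integral_sub (aux_int hp hfp ha) (aux_int hp hfp hb)]
  have e : (b - a) * μ.real {x | a < f x} =
      ∫ x, ({x | a < f x}).indicator (fun _ => b - a) x ∂μ := by
    rw [integral_indicator₀ (aux_null hfp a), setIntegral_const, smul_eq_mul, mul_comm]
  rw [e]
  refine integral_mono ((aux_int hp hfp ha).sub (aux_int hp hfp hb)) ?_ fun x => ?_
  · exact IntegrableOn.integrable_indicator₀ (integrableOn_const (aux_fin hp hfp ha).ne) (aux_null hfp a)
  · show max (f x - a) 0 - max (f x - b) 0 ≤ ({x | a < f x}).indicator (fun _ => b - a) x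
    by_cases hx : a < f x
    · have h : x ∈ {x | a < f x} := hx
      rw [Set.indicator_of_mem h, max_eq_left (by linarith)]
      linarith [le_max_left (f x - b) 0]
    · have h : x ∉ {x | a < f x} := hx
      rw [Set.indicator_of_notMem h, max_eq_right (a := f x - a) (by linarith)]
      linarith [le_max_right (f x - b) 0]

/-- Equality of the truncated integrals gives one inequality of distribution functions. -/
lemma aux_le {α β : Type*} [MeasurableSpace α] [MeasurableSpace β]
    {μ : Measure α} {ν : Measure β} {p : ℝ} (hp : 1 ≤ p)
    {f : α → ℝ} (hfp : MemLp f (ENNReal.ofReal p) μ)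
    {g : β → ℝ} (hgp : MemLp g (ENNReal.ofReal p) ν)
    (h : ∀ a : ℝ, 0 < a → ∫ x, max (f x - a) 0 ∂μ = ∫ y, max (g y - a) 0 ∂ν)
    {a : ℝ} (ha : 0 < a) : μ {x | a < f x} ≤ ν {y | a < g y} := by
  have key : ∀ b, a < b → μ {x | b < f x} ≤ ν {y | a < g y} := by
    intro b hab
    have h1 := aux_lower hp hfp ha hab
    have h2 := aux_upper hp hgp ha hab
    rw [h a ha, h b (ha.trans hab)] at h1
    have h3 := le_of_mul_le_mul_left (h1.trans h2) (sub_pos.2 hab)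
    exact (ENNReal.toReal_le_toReal (aux_fin hp hfp (ha.trans hab)).ne
      (aux_fin hp hgp ha).ne).1 h3
  have hU : {x | a < f x} = ⋃ n : ℕ, {x | a + 1 / ((n : ℝ) + 1) < f x} := by
    ext x
    simp only [Set.mem_ofPred_eq, Set.mem_iUnion]
    constructor
    · intro hx
      obtain ⟨n, hn⟩ := exists_nat_one_div_lt (sub_pos.2 hx)
      exact ⟨n, by linarith⟩
    · rintro ⟨n, hn⟩
      have : (0 : ℝ) < 1 / ((n : ℝ) + 1) := by positivity
      linarith
  rw [hU, Monotone.measure_iUnion]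
  · refine iSup_le fun n => key _ ?_
    have : (0 : ℝ) < 1 / ((n : ℝ) + 1) := by positivity
    linarith
  · intro i j hij x hx
    have hx' : a + 1 / ((i : ℝ) + 1) < f x := hx
    have := Nat.one_div_le_one_div (α := ℝ) hij
    show a + 1 / ((j : ℝ) + 1) < f x
    linarith

lemma aux_layer {α : Type*} [MeasurableSpace α] {μ : Measure α} {p : ℝ} (hp : 1 ≤ p)
    {f : α → ℝ} (hfp : MemLp f (ENNReal.ofReal p) μ) {a : ℝ} (ha : 0 < a) :
    ∫ x, max (f x - a) 0 ∂μ = ∫ t in Set.Ioi (0 : ℝ), μ.real {x | a + t < f x} := by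
  rw [(aux_int hp hfp ha).integral_eq_integral_meas_lt
    (Eventually.of_forall fun x => le_max_right _ _)]
  refine setIntegral_congr_fun measurableSet_Ioi fun t ht => ?_
  have ht' : 0 < t := ht
  show μ.real _ = μ.real _
  congr 1
  ext x
  simp only [Set.mem_ofPred_eq, lt_max_iff]
  constructor
  · rintro (h | h) <;> linarith
  · intro h
    left; linarith

/-- `f` is a rearrangement of `g` iff `f ⪯ g` and `g ⪯ f`, for nonnegative
`L^p` functions on measurable subsets of (possibly different) Euclidean spaces. -/
theorem stmt_17 (p : ℝ) (hp : 1 ≤ p) (m n : ℕ)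
    (U : Set (Fin m → ℝ)) (V : Set (Fin n → ℝ))
    (hU : MeasurableSet U) (hV : MeasurableSet V)
    (f : (Fin m → ℝ) → ℝ) (g : (Fin n → ℝ) → ℝ)
    (hf : ∀ x, 0 ≤ f x) (hg : ∀ y, 0 ≤ g y)
    (hfp : MemLp f (ENNReal.ofReal p) (MeasureTheory.volume.restrict U))
    (hgp : MemLp g (ENNReal.ofReal p) (MeasureTheory.volume.restrict V)) :
    (∀ a : ℝ, 0 < a →
        MeasureTheory.volume.restrict U {x | a < f x} =
          MeasureTheory.volume.restrict V {y | a < g y}) ↔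
      ((∀ a : ℝ, 0 < a →
          ∫ x in U, max (f x - a) 0 ≤ ∫ y in V, max (g y - a) 0) ∧
       (∀ a : ℝ, 0 < a →
          ∫ y in V, max (g y - a) 0 ≤ ∫ x in U, max (f x - a) 0)) := by
  constructor
  · intro h
    have e : ∀ a : ℝ, 0 < a →
        ∫ x in U, max (f x - a) 0 = ∫ y in V, max (g y - a) 0 := by
      intro a ha
      rw [aux_layer hp hfp ha, aux_layer hp hgp ha]
      refine setIntegral_congr_fun measurableSet_Ioi fun t ht => ?_
      have ht' : 0 < t := ht
      exact congrArg ENNReal.toReal (h (a + t) (by linarith))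
    exact ⟨fun a ha => (e a ha).le, fun a ha => (e a ha).ge⟩
  · rintro ⟨h1, h2⟩ a ha
    have e : ∀ a : ℝ, 0 < a →
        ∫ x in U, max (f x - a) 0 = ∫ y in V, max (g y - a) 0 :=
      fun a ha => le_antisymm (h1 a ha) (h2 a ha)
    exact le_antisymm (aux_le hp hfp hgp e ha)
      (aux_le hp hgp hfp (fun a ha => (e a ha).symm) ha)
end
end
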